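/- Let F be a field, N, p, q positive integers with p + q ≤ N, t = N − p − q, λ a partition of length ≤ N (extended by zeros), A an N×t matrix over F, u = (u₁,…,u_p) and v = (v₁,…,v_q) elements of F with u_j ≠ v_k for all 1 ≤ j ≤ p, 1 ≤ k ≤ q. Then: det [A | H^N_{t+1,λ}(u₁,…,u_p,v₁,…,v_q) | H^N_{t+2,λ}(u₂,…,u_p,v₁,…,v_q) | … | H^N_{t+p,λ}(u_p,v₁,…,v_q) | H^N_{t+p+1,λ}(v₁,…,v_q) | … | H^N_{t+p+q,λ}(v_q)] · ∏_{j=1}^p ∏_{k=1}^q (u_j − v_k) = det [A | H^N_{t+q+1,λ}(u₁,…,u_p) | H^N_{t+q+2,λ}(u₂,…,u_p) | … | H^N_{t+p+q,λ}(u_p) | H^N_{t+p+1,λ}(v₁,…,v_q) | … | H^N_{t+p+q,λ}(v_q)]. -/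

import Mathlib

open scoped BigOperators

/-- Complete homogeneous polynomial of degree `m` evaluated at the list `l`
(`h₀ = 1`, `h_m = 0` for `m < 0`). -/
def homEval {R : Type*} [CommRing R] (l : List R) (m : ℤ) : R :=
  if 0 ≤ m then
    ∑ f ∈ Finset.Nat.antidiagonalTuple l.length m.toNat, ∏ i, l.get i ^ f i
  else 0

/-- Elementary symmetric polynomial of degree `k` evaluated at the list `l`. -/
def esymmEval {R : Type*} [CommRing R] (l : List R) (k : ℕ) : R :=
  (((l : Multiset R).powersetCard k).map Multiset.prod).sum

/-- Power sum of degree `s` evaluated at the list `l`. -/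
def psumEval {R : Type*} [CommRing R] (l : List R) (s : ℕ) : R :=
  (l.map (· ^ s)).sum

/-- The list `y^[κ]`: `y q` repeated `κ q` times, in order. -/
def repList {R : Type*} {n : ℕ} (y : Fin n → R) (κ : Fin n → ℕ) : List R :=
  (List.ofFn fun q => List.replicate (κ q) (y q)).flatten

/-- Zero-based version of `γ(κ, p) = (q, r)`: the `p`-th entry (0-based) of the list
    `(0,0),…,(0,κ₀−1),(1,0),…,(1,κ₁−1),…`. -/
def gammaPair (n : ℕ) (κ : Fin n → ℕ) (p : ℕ) : ℕ × ℕ :=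
  ((List.ofFn fun q : Fin n => (List.range (κ q)).map fun r => ((q : ℕ), r)).flatten).getD p (0, 0)

/-- The generalized confluent Vandermonde matrix `G_λ(y, κ)` (zero-based indices):
`G[j,p] = binom(N+λ_j−j−1, r) · y_q^(N+λ_j−j−r−1)` if the exponent is `≥ 0`, else `0`,
where `(q, r) = gammaPair n κ p`. -/
def vanG (R : Type*) [CommRing R] {n : ℕ} (N : ℕ) (κ : Fin n → ℕ) (y : Fin n → R)
    (lam : Fin N → ℕ) : Matrix (Fin N) (Fin N) R :=
  Matrix.of fun j p =>
    if h : (gammaPair n κ (p : ℕ)).1 < n ∧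
        (j : ℕ) + (gammaPair n κ (p : ℕ)).2 + 1 ≤ N + lam j then
      (Nat.choose (N + lam j - ((j : ℕ) + 1)) (gammaPair n κ (p : ℕ)).2 : R) *
        y ⟨(gammaPair n κ (p : ℕ)).1, h.1⟩ ^
          (N + lam j - ((j : ℕ) + (gammaPair n κ (p : ℕ)).2 + 1))
    else 0

/-- The Jacobi–Trudi matrix `J_λ(x) = [h_{λ_j − j + k}(x)]`. -/
def jacobiTrudi (R : Type*) [CommRing R] (N : ℕ) (lam : Fin N → ℕ) (x : List R) :
    Matrix (Fin N) (Fin N) R :=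
  Matrix.of fun j k => homEval x ((lam j : ℤ) - (j : ℕ) + (k : ℕ))

/-- The matrix `M(y, κ)` with entries `(−1)^{N−k−r+1} e_{N−k−r+1}(y^[κ − r b_q])`
(in one-based form); entries with `N−k−r+1 < 0` are `0`. -/
def matM (R : Type*) [CommRing R] {n : ℕ} (N : ℕ) (κ : Fin n → ℕ) (y : Fin n → R) :
    Matrix (Fin N) (Fin N) R :=
  Matrix.of fun k p =>
    if h : (gammaPair n κ (p : ℕ)).1 < n ∧
        (k : ℕ) + (gammaPair n κ (p : ℕ)).2 + 1 ≤ N then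
      (-1 : R) ^ (N - ((k : ℕ) + (gammaPair n κ (p : ℕ)).2 + 1)) *
        esymmEval
          (repList y (Function.update κ ⟨(gammaPair n κ (p : ℕ)).1, h.1⟩
            (κ ⟨(gammaPair n κ (p : ℕ)).1, h.1⟩ - ((gammaPair n κ (p : ℕ)).2 + 1))))
          (N - ((k : ℕ) + (gammaPair n κ (p : ℕ)).2 + 1))
    else 0

/-- The column vector `H^N_{s,λ}(l) = (h_{s + λ_j − j}(l))_{j=1}^N` (one-based `j`). -/
def Hcol {R : Type*} [CommRing R] {N : ℕ} (lam : Fin N → ℕ) (s : ℕ) (l : List R) :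
    Fin N → R :=
  fun j => homEval l ((s : ℤ) + lam j - ((j : ℕ) + 1))

theorem homEval_of_neg {R : Type*} [CommRing R] (l : List R) {m : ℤ} (hm : m < 0) :
    homEval l m = 0 :=
  if_neg (not_le.mpr hm)

theorem homEval_natCast {R : Type*} [CommRing R] (l : List R) (n : ℕ) :
    homEval l (n : ℤ) =
      ∑ f ∈ Finset.Nat.antidiagonalTuple l.length n, ∏ i, l.get i ^ f i := by
  simp [homEval]

theorem sum_antidiagonalTuple_succ {M : Type*} [AddCommMonoid M] (k n : ℕ)
    (g : (Fin (k + 1) → ℕ) → M) :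
    ∑ f ∈ Finset.Nat.antidiagonalTuple (k + 1) n, g f =
      ∑ x ∈ Finset.HasAntidiagonal.antidiagonal n,
        ∑ f ∈ Finset.Nat.antidiagonalTuple k x.2, g (Fin.cons x.1 f) := by
  rw [Finset.sum_sigma']
  refine Finset.sum_bij' (fun f _ => ⟨(f 0, ∑ i, f (Fin.succ i)), Fin.tail f⟩)
    (fun x _ => Fin.cons x.1.1 x.2) ?_ ?_ ?_ ?_ ?_
  · intro f hf
    rw [Finset.Nat.mem_antidiagonalTuple, Fin.sum_univ_succ] at hf
    simp [Finset.Nat.mem_antidiagonalTuple, Fin.tail, hf]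
  · rintro ⟨⟨a, b⟩, f⟩ hf
    simp only [Finset.mem_sigma, Finset.HasAntidiagonal.mem_antidiagonal,
      Finset.Nat.mem_antidiagonalTuple] at hf
    simp [Finset.Nat.mem_antidiagonalTuple, Fin.sum_univ_succ, hf.1, hf.2]
  · intro f _
    simp
  · rintro ⟨⟨a, b⟩, f⟩ hf
    simp only [Finset.mem_sigma, Finset.HasAntidiagonal.mem_antidiagonal,
      Finset.Nat.mem_antidiagonalTuple] at hf
    obtain ⟨-, rfl⟩ := hf
    simp
  · intro f _
    simp

theorem homEval_cons_natCast {R : Type*} [CommRing R] (a : R) (l : List R) (n : ℕ) :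
    homEval (a :: l) (n : ℤ) =
      ∑ x ∈ Finset.HasAntidiagonal.antidiagonal n, a ^ x.1 * homEval l (x.2 : ℤ) := by
  simp only [homEval_natCast, Finset.mul_sum]
  refine (sum_antidiagonalTuple_succ l.length n _).trans ?_
  refine Finset.sum_congr rfl fun x _ => Finset.sum_congr rfl fun f _ => ?_
  exact (Fin.prod_univ_succ _).trans (by simp)

theorem homEval_cons {R : Type*} [CommRing R] (a : R) (l : List R) (m : ℤ) :
    homEval (a :: l) m = homEval l m + a * homEval (a :: l) (m - 1) := by
  rcases lt_or_ge m 0 with hm | hm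
  · simp [homEval_of_neg, hm, show m - 1 < 0 by lia]
  · lift m to ℕ using hm
    cases m with
    | zero =>
      rw [homEval_cons_natCast, homEval_of_neg (a :: l) (by simp)]
      simp
    | succ n =>
      rw [homEval_cons_natCast, Finset.Nat.sum_antidiagonal_succ, Nat.cast_succ,
        add_sub_cancel_right, homEval_cons_natCast, Finset.mul_sum]
      simp [pow_succ', mul_assoc]

/-- The recursion `homEval_cons` holds for a variable at any position of the list. -/
theorem homEval_append_cons {R : Type*} [CommRing R] (l₁ : List R) (b : R) (l₂ : List R)
    (m : ℤ) :
    homEval (l₁ ++ b :: l₂) m =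
      homEval (l₁ ++ l₂) m + b * homEval (l₁ ++ b :: l₂) (m - 1) := by
  induction l₁ generalizing m with
  | nil => exact homEval_cons b l₂ m
  | cons a l ih =>
    rcases lt_or_ge m 0 with hm | hm
    · simp [homEval_of_neg, hm, show m - 1 < 0 by lia]
    · lift m to ℕ using hm
      simp only [List.cons_append]
      induction m with
      | zero =>
        have h₁ := homEval_cons a (l ++ b :: l₂) 0
        have h₂ := homEval_cons a (l ++ l₂) 0
        have h₃ := ih 0
        simp only [homEval_of_neg _ (show (0 : ℤ) - 1 < 0 by lia)] at h₁ h₂ h₃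
        simp only [Nat.cast_zero, homEval_of_neg _ (show (0 : ℤ) - 1 < 0 by lia)]
        linear_combination h₁ - h₂ + h₃
      | succ n ihn =>
        have h₁ := homEval_cons a (l ++ b :: l₂) (n + 1)
        have h₂ := homEval_cons a (l ++ l₂) (n + 1)
        have h₃ := homEval_cons a (l ++ b :: l₂) n
        have h₄ := ih (n + 1)
        simp only [add_sub_cancel_right] at h₁ h₂ h₄
        rw [Nat.cast_succ, add_sub_cancel_right]
        linear_combination h₁ - h₂ + h₄ - b * h₃ + a * ihn

/-- The divided difference identity for complete homogeneous polynomials. -/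
theorem sub_mul_homEval {R : Type*} [CommRing R] (a b : R) (l₁ l₂ : List R) (m : ℤ) :
    (a - b) * homEval (a :: (l₁ ++ b :: l₂)) m =
      homEval (a :: (l₁ ++ l₂)) (m + 1) - homEval (l₁ ++ b :: l₂) (m + 1) := by
  have h₁ := homEval_cons a (l₁ ++ b :: l₂) (m + 1)
  have h₂ := homEval_append_cons (a :: l₁) b l₂ (m + 1)
  simp only [add_sub_cancel_right, List.cons_append] at h₁ h₂
  linear_combination h₂ - h₁

/-- The matrix in which the variables `v₁,…,v_k` have been removed from the `u`-columns. -/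
def eliminationMatrix {F : Type*} [CommRing F] {N p q t : ℕ} (lam : Fin N → ℕ)
    (A : Matrix (Fin N) (Fin t) F) (u : Fin p → F) (v : Fin q → F) (k : ℕ) :
    Matrix (Fin N) (Fin N) F :=
  Matrix.of fun i (c : Fin N) =>
    if hc : (c : ℕ) < t then A i ⟨(c : ℕ), hc⟩
    else if (c : ℕ) < t + p then
      Hcol lam ((c : ℕ) + k + 1)
        ((List.ofFn u).drop ((c : ℕ) - t) ++ (List.ofFn v).drop k) i
    else
      Hcol lam ((c : ℕ) + 1) ((List.ofFn v).drop ((c : ℕ) - t - p)) i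

/-- A lower triangular matrix whose right multiplication scales the column `c` by `d c` and adds
to it the column `s c`, when `s c` is beyond `c`. -/
def columnShift {R : Type*} [CommRing R] {N : ℕ} (d : Fin N → R) (s : Fin N → Fin N) :
    Matrix (Fin N) (Fin N) R :=
  Matrix.of fun i c => if i = c then d c else if c < i ∧ i = s c then 1 else 0

theorem det_columnShift {R : Type*} [CommRing R] {N : ℕ} (d : Fin N → R)
    (s : Fin N → Fin N) : (columnShift d s).det = ∏ c, d c := by
  rw [Matrix.det_of_isLowerTriangular]
  · simp [columnShift]
  · intro i c hic
    have hic : i < c := hic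
    simp [columnShift, hic.ne, hic.not_gt]

theorem mul_columnShift_apply {R : Type*} [CommRing R] {N : ℕ}
    (M : Matrix (Fin N) (Fin N) R) (d : Fin N → R) (s : Fin N → Fin N) (i c : Fin N) :
    (M * columnShift d s) i c = M i c * d c + if c < s c then M i (s c) else 0 := by
  have h : ∀ x, M i x * columnShift d s x c =
      (if x = c then M i c * d c else 0) +
        (if x = s c then (if c < s c then M i (s c) else 0) else 0) := by
    intro x
    by_cases hx : x = c
    · subst hx
      by_cases hs : x = s x
      · simp [columnShift, ← hs]
      · simp [columnShift, hs]
    · by_cases hs : x = s c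
      · subst hs
        simp [columnShift, hx]
      · simp [columnShift, hx, hs]
  simp [Matrix.mul_apply, h, Finset.sum_add_distrib]

/-- The index of the column that must be added to the column `c` to eliminate `v_k`. -/
def eliminationShift {p q t : ℕ} (k : Fin q) (c : Fin (t + p + q)) : Fin (t + p + q) :=
  if (c : ℕ) < t ∨ t + p ≤ c then c
  else if h : (c : ℕ) + 1 < t + p then ⟨c + 1, by lia⟩ else ⟨t + p + k, by lia⟩

theorem eliminationMatrix_succ {F : Type*} [CommRing F] {p q t : ℕ}
    (lam : Fin (t + p + q) → ℕ) (A : Matrix (Fin (t + p + q)) (Fin t) F)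
    (u : Fin p → F) (v : Fin q → F) (k : Fin q) :
    eliminationMatrix lam A u v (k + 1) =
      eliminationMatrix lam A u v k *
        columnShift
          (Fin.append (Fin.append (fun _ : Fin t => 1) fun j => u j - v k) fun _ : Fin q => 1)
          (eliminationShift k) := by
  ext i c
  rw [mul_columnShift_apply]
  induction c using Fin.addCases with
  | right c => simp [eliminationShift, eliminationMatrix, add_assoc]
  | left c =>
    induction c using Fin.addCases with
    | left c => simp [eliminationShift, eliminationMatrix]
    | right j =>
      have hu : (List.ofFn u).drop j = u j :: (List.ofFn u).drop (j + 1) := by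
        rw [List.drop_eq_getElem_cons (by simp)]
        simp
      have hv : (List.ofFn v).drop k = v k :: (List.ofFn v).drop (k + 1) := by
        rw [List.drop_eq_getElem_cons (by simp)]
        simp
      have key : ∀ (U : List F) (m m₁ m₂ : ℤ), m₁ = m + 1 → m₂ = m + 1 →
          homEval (u j :: (U ++ (List.ofFn v).drop (k + 1))) m₁ =
            homEval (u j :: (U ++ v k :: (List.ofFn v).drop (k + 1))) m * (u j - v k) +
              homEval (U ++ v k :: (List.ofFn v).drop (k + 1)) m₂ := by
        rintro U m _ _ rfl rfl
        linear_combination -sub_mul_homEval (u j) (v k) U ((List.ofFn v).drop (k + 1)) m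
      by_cases hj : (j : ℕ) + 1 < p
      · have hs : eliminationShift k (Fin.castAdd q (Fin.natAdd t j)) =
            ⟨t + j + 1, by lia⟩ := by
          simp [eliminationShift, add_assoc, hj]
        rw [hs]
        simp [eliminationMatrix, Hcol, Fin.lt_def, hu, hv, add_assoc, hj]
        exact key _ _ _ _ (by ring) (by ring)
      · have hs : eliminationShift k (Fin.castAdd q (Fin.natAdd t j)) =
            ⟨t + p + k, by lia⟩ := by
          simp [eliminationShift, add_assoc, hj]
        rw [hs]
        have hnil : (List.ofFn u).drop (j + 1) = [] := by simp; lia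
        simp [eliminationMatrix, Hcol, Fin.lt_def, hu, hv, hnil, add_assoc,
          show (j : ℕ) < p + k by lia]
        exact key [] _ _ _ (by ring) (by lia)

theorem det_eliminationMatrix_succ {F : Type*} [CommRing F] {p q t : ℕ}
    (lam : Fin (t + p + q) → ℕ) (A : Matrix (Fin (t + p + q)) (Fin t) F)
    (u : Fin p → F) (v : Fin q → F) (k : Fin q) :
    (eliminationMatrix lam A u v (k + 1)).det =
      (eliminationMatrix lam A u v k).det * ∏ j, (u j - v k) := by
  rw [eliminationMatrix_succ, Matrix.det_mul, det_columnShift]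
  simp [Fin.prod_univ_add]

theorem det_eliminationMatrix {F : Type*} [CommRing F] {p q t : ℕ}
    (lam : Fin (t + p + q) → ℕ) (A : Matrix (Fin (t + p + q)) (Fin t) F)
    (u : Fin p → F) (v : Fin q → F) :
    (eliminationMatrix lam A u v q).det =
      (eliminationMatrix lam A u v 0).det * ∏ j, ∏ k, (u j - v k) := by
  have h : ∀ (n : ℕ) (hn : n ≤ q), (eliminationMatrix lam A u v n).det =
      (eliminationMatrix lam A u v 0).det *
        ∏ k : Fin n, ∏ j, (u j - v (Fin.castLE hn k)) := by
    intro n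
    induction n with
    | zero => simp
    | succ n ih =>
      intro hn
      rw [Fin.prod_univ_castSucc, ← mul_assoc]
      refine (det_eliminationMatrix_succ lam A u v ⟨n, hn⟩).trans ?_
      rw [ih (by lia)]
      rfl
  rw [h q le_rfl, Finset.prod_comm]
  simp

/-- elimination of the variables `v₁,…,v_q` from the `u`-columns:
multiplying the determinant of
`[A | H_{t+1}(u₁,…,u_p,v) | … | H_{t+p}(u_p,v) | H_{t+p+1}(v₁,…,v_q) | … | H_{t+p+q}(v_q)]`
by `∏_{j,k} (u_j − v_k)` gives the determinant of
`[A | H_{t+q+1}(u₁,…,u_p) | … | H_{t+p+q}(u_p) | H_{t+p+1}(v₁,…,v_q) | … | H_{t+p+q}(v_q)]`. -/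
theorem elimination_lemma {F : Type*} [Field F]
    (N p q : ℕ) (hp : 0 < p) (hq : 0 < q) (hpq : p + q ≤ N)
    (t : ℕ) (ht : t = N - p - q)
    (lam : Fin N → ℕ) (hlam : Antitone lam)
    (A : Matrix (Fin N) (Fin t) F)
    (u : Fin p → F) (v : Fin q → F) (huv : ∀ j k, u j ≠ v k) :
    (Matrix.det (Matrix.of fun i (c : Fin N) =>
        if hc : (c : ℕ) < t then A i ⟨(c : ℕ), hc⟩
        else if (c : ℕ) < t + p then
          Hcol lam ((c : ℕ) + 1)
            ((List.ofFn u).drop ((c : ℕ) - t) ++ List.ofFn v) i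
        else
          Hcol lam ((c : ℕ) + 1) ((List.ofFn v).drop ((c : ℕ) - t - p)) i)) *
      (∏ j, ∏ k, (u j - v k)) =
    Matrix.det (Matrix.of fun i (c : Fin N) =>
        if hc : (c : ℕ) < t then A i ⟨(c : ℕ), hc⟩
        else if (c : ℕ) < t + p then
          Hcol lam ((c : ℕ) + q + 1) ((List.ofFn u).drop ((c : ℕ) - t)) i
        else
          Hcol lam ((c : ℕ) + 1) ((List.ofFn v).drop ((c : ℕ) - t - p)) i) := by
  obtain rfl : N = t + p + q := by lia
  have h := det_eliminationMatrix lam A u v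
  have hv : (List.ofFn v).drop q = [] := by simp
  simp only [eliminationMatrix, hv, List.append_nil, List.drop_zero, add_zero] at h
  exact h.symm
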